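/- arXiv:1611.01251 — 3 statements merged into one kernel-verified Lean document; each statement's English description precedes it below -/
import Mathlib

section
/- Let F be a field and k ≤ n positive integers. The set of monomials x_1^{a_1}x_2^{a_2}⋯x_n^{a_n} whose exponent sequence (a_1,…,a_n) is componentwise ≤ some (n,k)-staircase descends to an F-vector space basis of the quotient S_{n,k} = F[x_1,…,x_n]/J_{n,k}. -/
open scoped Classical
open MvPolynomial

noncomputable section

namespace OSPHecke

/-- Stirling numbers of the second kind. -/
def stirling : ℕ → ℕ → ℕ
  | 0, 0 => 1
  | 0, _ + 1 => 0
  | _ + 1, 0 => 0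
  | n + 1, k + 1 => stirling n k + (k + 1) * stirling n (k + 1)

/-- The `q`-analogue `[k]_q = 1 + q + ⋯ + q^{k-1}` as a polynomial in `q` over `ℕ`. -/
def qnat (k : ℕ) : Polynomial ℕ := ∑ t ∈ Finset.range k, Polynomial.X ^ t

/-- The `q`-factorial `[k]!_q`. -/
def qfact : ℕ → Polynomial ℕ
  | 0 => 1
  | k + 1 => qnat (k + 1) * qfact k

/-- The `q`-Stirling numbers `Stir_q(n,k)`, defined by
`Stir_q(n,k) = Stir_q(n-1,k-1) + [k]_q · Stir_q(n-1,k)` and `Stir_q(0,k) = δ_{0,k}`. -/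
def qstirling : ℕ → ℕ → Polynomial ℕ
  | 0, 0 => 1
  | 0, _ + 1 => 0
  | _ + 1, 0 => 0
  | n + 1, k + 1 => qstirling n k + qnat (k + 1) * qstirling n (k + 1)

variable (F : Type*) [Field F]

/-- The complete homogeneous symmetric polynomial of degree `d` in the first `m`
variables `x_1, …, x_m` of `F[x_1, …, x_n]` (variables are 0-indexed). -/
def hpoly (n d m : ℕ) : MvPolynomial (Fin n) F :=
  ∑ s ∈ Finset.univ.filter (fun s : Sym (Fin n) d => ∀ j ∈ s.1, (j : ℕ) < m),
    (s.1.map MvPolynomial.X).prod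

/-- The ideal `J_{n,k}` generated by `h_k(x_1), h_k(x_1,x_2), …, h_k(x_1,…,x_n)` and
`e_n(x_n), e_{n-1}(x_n), …, e_{n-k+1}(x_n)`. -/
def Jideal (n k : ℕ) : Ideal (MvPolynomial (Fin n) F) :=
  Ideal.span ({f | ∃ m, 1 ≤ m ∧ m ≤ n ∧ f = hpoly F n k m} ∪
    {f | ∃ d, n - k < d ∧ d ≤ n ∧ f = MvPolynomial.esymm (Fin n) F d})

/-- The neglex order on exponent vectors: `a < b` iff there is a position `j` with
`a j < b j` and `a l = b l` for all `l > j`. -/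
def NeglexLt {n : ℕ} (a b : Fin n → ℕ) : Prop :=
  ∃ j : Fin n, a j < b j ∧ ∀ l, j < l → a l = b l

/-- The value `w(t+1)` of a permutation at the 1-based position `t+1`
(0-based position `t`); extended by `0` outside the range. -/
def permVal {n : ℕ} (w : Equiv.Perm (Fin n)) (t : ℕ) : ℕ :=
  if h : t < n then (w ⟨t, h⟩ : ℕ) else 0

/-- The descent set of a permutation, recorded 1-based:
`Des(w) = {j ∈ [n-1] : w(j) > w(j+1)}`. -/
def permDes {n : ℕ} (w : Equiv.Perm (Fin n)) : Finset ℕ :=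
  (Finset.Ico 1 n).filter fun j => permVal w j < permVal w (j - 1)

/-- The inversion number (= Coxeter length) of a permutation. -/
def invCount {n : ℕ} (w : Equiv.Perm (Fin n)) : ℕ :=
  ((Finset.univ : Finset (Fin n × Fin n)).filter fun p => p.1 < p.2 ∧ w p.2 < w p.1).card

/-- The descent set (1-based) of a sequence `i = (i_1, i_2, …)`, given 0-based as
`i : ℕ → ℕ`: `Des(i) = {j ∈ [n-1] : i_j > i_{j+1}}`. -/
def seqDes (n : ℕ) (i : ℕ → ℕ) : Finset ℕ :=
  (Finset.Ico 1 n).filter fun j => i j < i (j - 1)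

/-- `α` is a composition of `n`. -/
def IsComposition (n : ℕ) (α : List ℕ) : Prop := α.sum = n ∧ ∀ a ∈ α, 0 < a

/-- The descent set of a composition: the partial sums `α_1, α_1+α_2, …`
excluding the total sum. -/
def desComp (α : List ℕ) : Finset ℕ :=
  ((Finset.range α.length).filter fun t => 0 < t).image fun t => (α.take t).sum

/-- The variable `x_{t+1}` (0-based index `t`), extended by `0` out of range. -/
def Xv (n : ℕ) (t : ℕ) : MvPolynomial (Fin n) F :=
  if h : t < n then MvPolynomial.X ⟨t, h⟩ else 0

/-- The adjacent transposition exchanging the 0-based indices `t` and `t+1`. -/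
def adjSwap (n t : ℕ) : Equiv.Perm (Fin n) :=
  if h : t + 1 < n then Equiv.swap ⟨t, Nat.lt_of_succ_lt h⟩ ⟨t + 1, h⟩ else 1

/-- `PibarRel F n t f g` says that `g = π̄_t(f)`, where (0-based indices `t`, `t+1`)
`π̄_t(f) = (x_{t+1}·(f - s_t(f)))/(x_t - x_{t+1}) = π_t(f) - f`; since `F[x]` is an
integral domain such a `g` is unique when it exists (and it always exists). -/
def PibarRel (n t : ℕ) (f g : MvPolynomial (Fin n) F) : Prop :=
  (Xv F n t - Xv F n (t + 1)) * g =
    Xv F n (t + 1) * (f - MvPolynomial.rename (⇑(adjSwap n t)) f)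

/-- The permutation associated to a word of (0-based) adjacent transposition indices. -/
def wordPerm (n : ℕ) (L : List ℕ) : Equiv.Perm (Fin n) := (L.map (adjSwap n)).prod

/-- `L` is a reduced word for `w`. -/
def IsReducedWord (n : ℕ) (L : List ℕ) (w : Equiv.Perm (Fin n)) : Prop :=
  (∀ t ∈ L, t + 1 < n) ∧ wordPerm n L = w ∧
    ∀ L' : List ℕ, (∀ t ∈ L', t + 1 < n) → wordPerm n L' = w → L.length ≤ L'.length

/-- `g` is a chain of successive applications of the operators `π̄` along the word `L`,
applied right-to-left (so `g (t+1) = π̄_{L.reverse[t]} (g t)`). -/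
def PibarChain (n : ℕ) (L : List ℕ) (g : ℕ → MvPolynomial (Fin n) F) : Prop :=
  ∀ t, t < L.length → PibarRel F n (L.reverse.getD t 0) (g t) (g (t + 1))

/-- `p = π̄_w(f)`, computed along some reduced word for `w`. -/
def IsPibarApplied (n : ℕ) (w : Equiv.Perm (Fin n)) (f p : MvPolynomial (Fin n) F) : Prop :=
  ∃ (L : List ℕ) (g : ℕ → MvPolynomial (Fin n) F),
    IsReducedWord n L w ∧ g 0 = f ∧ PibarChain F n L g ∧ g L.length = p

/-- The monomial `x_{α,i} = (∏_{j ∈ Des(α)} x_1⋯x_j) · x_1^{i_1}⋯x_n^{i_n}`. -/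
def xAI (n : ℕ) (α : List ℕ) (i : ℕ → ℕ) : MvPolynomial (Fin n) F :=
  (∏ j ∈ desComp α, ∏ t ∈ Finset.range j, Xv F n t) *
    ∏ t ∈ Finset.range n, Xv F n t ^ i t

/-- The defining conditions for the index set `A_{n,k}`: `α` is a composition of `n`
with `α_1 > n-k`, and `k - ℓ(α) ≥ i_1 ≥ ⋯ ≥ i_{n-k} ≥ 0 = i_{n-k+1} = ⋯ = i_n`
(the sequence `i` is 0-indexed: `i t` is the paper's `i_{t+1}`). -/
def Acond (n k : ℕ) (α : List ℕ) (i : ℕ → ℕ) : Prop :=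
  IsComposition n α ∧ n - k < α.headI ∧ i 0 + α.length ≤ k ∧
    (∀ a b, a ≤ b → b < n - k → i b ≤ i a) ∧ ∀ t, n - k ≤ t → i t = 0

/-- The exponent vector of the generalized Garsia–Stanton monomial `gs_{w,i}`:
the variable `x_{w(t)}` has exponent `#{d ∈ Des(w) : d ≥ t} + i_t` (1-based `t`). -/
def gsExp {n : ℕ} (w : Equiv.Perm (Fin n)) (i : ℕ → ℕ) : Fin n → ℕ := fun m =>
  ((permDes w).filter fun r => (w.symm m : ℕ) + 1 ≤ r).card + i (w.symm m : ℕ)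

/-- The generalized Garsia–Stanton monomial `gs_{w,i}`. -/
def gsMono (n : ℕ) (w : Equiv.Perm (Fin n)) (i : ℕ → ℕ) : MvPolynomial (Fin n) F :=
  ∏ m : Fin n, MvPolynomial.X m ^ gsExp w i m

/-- The condition `k - des(w) > i_1 ≥ ⋯ ≥ i_{n-k} ≥ 0 = i_{n-k+1} = ⋯ = i_n` defining
membership of `gs_{w,i}` in `GS_{n,k}`. -/
def GScond (n k : ℕ) (w : Equiv.Perm (Fin n)) (i : ℕ → ℕ) : Prop :=
  i 0 + (permDes w).card < k ∧ (∀ a b, a ≤ b → b < n - k → i b ≤ i a) ∧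
    ∀ t, n - k ≤ t → i t = 0

/-- An ordered set partition of `[n]` with `k` blocks: a `k`-tuple of nonempty,
pairwise disjoint subsets of `Fin n` covering `Fin n`. -/
def OSP (n k : ℕ) : Type :=
  {B : Fin k → Finset (Fin n) // (∀ j, (B j).Nonempty) ∧
    (∀ j l, j ≠ l → ∀ x, x ∈ B j → x ∉ B l) ∧ ∀ x, ∃ j, x ∈ B j}

/-- Relabelling the letters of an ordered set partition by a permutation. -/
def ospMap {n k : ℕ} (e : Equiv.Perm (Fin n)) (σ : OSP n k) : OSP n k :=
  ⟨fun j => (σ.1 j).image e, by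
    obtain ⟨h1, h2, h3⟩ := σ.2
    refine ⟨fun j => (h1 j).image e, fun j l hjl x hx hx' => ?_, fun x => ?_⟩
    · rcases Finset.mem_image.1 hx with ⟨y, hy, hey⟩
      rcases Finset.mem_image.1 hx' with ⟨y', hy', hey'⟩
      have : y = y' := e.injective (hey.trans hey'.symm)
      exact h2 j l hjl y hy (this ▸ hy')
    · rcases h3 (e.symm x) with ⟨j, hj⟩
      exact ⟨j, Finset.mem_image.2 ⟨e.symm x, hj, e.apply_symm_apply x⟩⟩⟩

/-- `b` lies in a block strictly to the left of the block of `a`. -/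
def leftOf {n k : ℕ} (σ : OSP n k) (a b : Fin n) : Prop :=
  ∃ p q : Fin k, p < q ∧ b ∈ σ.1 p ∧ a ∈ σ.1 q

/-- `a` and `b` lie in the same block. -/
def sameBlock {n k : ℕ} (σ : OSP n k) (a b : Fin n) : Prop :=
  ∃ p : Fin k, a ∈ σ.1 p ∧ b ∈ σ.1 p

/-- The value of the 0-Hecke generator `π` (for the pair of letters `a = i`,
`b = i+1`) on a basis element of `F[OP_{n,k}]`. -/
def heckeImg {n k : ℕ} (a b : Fin n) (σ : OSP n k) : OSP n k →₀ F :=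
  if leftOf σ a b then 0
  else if sameBlock σ a b then Finsupp.single σ 1
  else Finsupp.single σ 1 + Finsupp.single (ospMap (Equiv.swap a b) σ) 1

/-- The 0-Hecke operator `π` on `F[OP_{n,k}]` for the pair of letters `a = i`, `b = i+1`. -/
def heckeOp {n k : ℕ} (a b : Fin n) (f : OSP n k →₀ F) : OSP n k →₀ F :=
  f.sum fun σ c => c • heckeImg F a b σ

/-- The value of the 0-Hecke generator `π̄ = π - 1` on a basis element of `F[OP_{n,k}]`. -/
def pibarImg {n k : ℕ} (a b : Fin n) (σ : OSP n k) : OSP n k →₀ F :=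
  if leftOf σ a b then -Finsupp.single σ 1
  else if sameBlock σ a b then 0
  else Finsupp.single (ospMap (Equiv.swap a b) σ) 1

/-- The 0-Hecke operator `π̄ = π - 1` on `F[OP_{n,k}]`. -/
def pibarOp {n k : ℕ} (a b : Fin n) (f : OSP n k →₀ F) : OSP n k →₀ F :=
  f.sum fun σ c => c • pibarImg F a b σ

/-- `IsShuffle l₁ l₂ l` : `l` is an interleaving of `l₁` and `l₂` preserving the
relative order of the entries of each. -/
inductive IsShuffle : List ℕ → List ℕ → List ℕ → Prop
  | nil : IsShuffle [] [] []
  | left {a l₁ l₂ l} : IsShuffle l₁ l₂ l → IsShuffle (a :: l₁) l₂ (a :: l)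
  | right {a l₁ l₂ l} : IsShuffle l₁ l₂ l → IsShuffle l₁ (a :: l₂) (a :: l)

/-- An `(n,k)`-staircase: a shuffle of `(k-1, k-2, …, 1, 0)` with `n-k` copies of `k-1`. -/
def IsStaircase (n k : ℕ) (s : Fin n → ℕ) : Prop :=
  ∃ L : List ℕ, IsShuffle ((List.range k).reverse) (List.replicate (n - k) (k - 1)) L ∧
    ∀ j : Fin n, s j = L.getD (j : ℕ) 0

/-- `B` is an ordered set partition of `[n]` (`n = α.sum`) of shape `α`. -/
def IsOSPShape (α : List ℕ) (B : Fin α.length → Finset (Fin α.sum)) : Prop :=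
  (∀ j, (B j).card = α.get j) ∧
    (∀ j l, j ≠ l → ∀ x, x ∈ B j → x ∉ B l) ∧ ∀ x, ∃ j, x ∈ B j

/-- The ordered set partition `({1,…,α_1} | {α_1+1,…,α_1+α_2} | ⋯)` of shape `α`,
as a tuple of blocks. -/
def sigma0 (α : List ℕ) : Fin α.length → Finset (Fin α.sum) := fun j =>
  Finset.univ.filter fun x =>
    (α.take (j : ℕ)).sum ≤ (x : ℕ) ∧ (x : ℕ) < (α.take ((j : ℕ) + 1)).sum

section Shape

variable {n ℓ : ℕ}

/-- `b` lies in a block strictly to the left of the block of `a` (tuples of blocks). -/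
def blkLeft (B : Fin ℓ → Finset (Fin n)) (a b : Fin n) : Prop :=
  ∃ p q : Fin ℓ, p < q ∧ b ∈ B p ∧ a ∈ B q

/-- `a` and `b` lie in the same block (tuples of blocks). -/
def blkSame (B : Fin ℓ → Finset (Fin n)) (a b : Fin n) : Prop :=
  ∃ p : Fin ℓ, a ∈ B p ∧ b ∈ B p

/-- The value of the 0-Hecke generator `π` (for letters `a = i`, `b = i+1`) on a basis
element of the free module on tuples of blocks. -/
def shapeImg (a b : Fin n) (B : Fin ℓ → Finset (Fin n)) :
    (Fin ℓ → Finset (Fin n)) →₀ F :=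
  if blkLeft B a b then 0
  else if blkSame B a b then Finsupp.single B 1
  else Finsupp.single B 1 + Finsupp.single (fun j => (B j).image (Equiv.swap a b)) 1

/-- The 0-Hecke operator `π` on the free module on tuples of blocks. -/
def shapeOp (a b : Fin n) (f : (Fin ℓ → Finset (Fin n)) →₀ F) :
    (Fin ℓ → Finset (Fin n)) →₀ F :=
  f.sum fun B c => c • shapeImg F a b B

end Shape

/-- A `k`-tuple of blocks is an ordered set partition of `[n]` with `k` blocks. -/
def IsOSPFun {n k : ℕ} (B : Fin k → Finset (Fin n)) : Prop :=
  (∀ j, (B j).Nonempty) ∧ (∀ j l, j ≠ l → ∀ x, x ∈ B j → x ∉ B l) ∧ ∀ x, ∃ j, x ∈ B j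

/-- The `t`-th block (0-based) of a tuple of blocks, extended by `∅` out of range. -/
def blockExt {n k : ℕ} (B : Fin k → Finset (Fin n)) (t : ℕ) : Finset (Fin n) :=
  if h : t < k then B ⟨t, h⟩ else ∅

/-- The word (values in `{1, …, n}`) obtained by listing the elements of each block in
increasing order, reading the blocks from left to right. -/
def ospWord {n k : ℕ} (B : Fin k → Finset (Fin n)) : List ℕ :=
  (List.finRange k).flatMap fun j => ((B j).sort (· ≤ ·)).map fun x => (x : ℕ) + 1

/-- The major index of a word: the sum of the (1-based) positions `j` with
`L_j > L_{j+1}`. -/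
def wordMaj (L : List ℕ) : ℕ :=
  ∑ j ∈ Finset.range (L.length - 1), if L.getD (j + 1) 0 < L.getD j 0 then j + 1 else 0

/-- The major index of an ordered set partition `σ = (B_1 | ⋯ | B_k)`:
`maj(σ) = maj(w) + ∑_{i : max(B_i) < min(B_{i+1})} (α_1 + ⋯ + α_i - i)`. -/
def ospMaj {n k : ℕ} (B : Fin k → Finset (Fin n)) : ℕ :=
  wordMaj (ospWord B) +
    ∑ t ∈ Finset.range (k - 1),
      if ∀ a ∈ blockExt B t, ∀ b ∈ blockExt B (t + 1), a < b then
        (∑ j ∈ Finset.range (t + 1), (blockExt B j).card) - (t + 1)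
      else 0

/-- The complete homogeneous symmetric function of degree `d` evaluated at field
elements `v_1, …, v_n`. -/
def hval {n : ℕ} (v : Fin n → F) (d : ℕ) : F :=
  ∑ s ∈ (Finset.univ : Finset (Sym (Fin n) d)), (s.1.map v).prod

/-- The elementary symmetric function of degree `d` evaluated at field elements
`v_1, …, v_n` (it vanishes for `d > n`). -/
def esymval {n : ℕ} (v : Fin n → F) (d : ℕ) : F :=
  ∑ t ∈ Finset.powersetCard d Finset.univ, ∏ j ∈ t, v j

end OSPHecke

namespace OSPHecke

/-- The geometric power series `∑ x^d T^d`, the inverse of `1 - x T`. -/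
def geomSeries {R : Type*} [CommRing R] (x : R) : PowerSeries R := PowerSeries.mk fun d => x ^ d

/-- The generating series of the elementary symmetric polynomials. -/
def elemSeries {R : Type*} [CommRing R] {n : ℕ} (x : Fin n → R) : PowerSeries R :=
  ∏ i, (1 + PowerSeries.C (x i) * PowerSeries.X)

/-- The generating series of the complete homogeneous symmetric polynomials in the first `m`
entries of `x`. -/
def homSeries {R : Type*} [CommRing R] {n : ℕ} (x : Fin n → R) (m : ℕ) : PowerSeries R :=
  ∏ i ∈ Finset.univ.filter (fun i : Fin n => (i : ℕ) < m), geomSeries (x i)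

section Series

variable {R S : Type*} [CommRing R] [CommRing S] {n : ℕ}

theorem one_sub_mul_geomSeries (x : R) :
    (1 - PowerSeries.C x * PowerSeries.X) * geomSeries x = 1 := by
  ext d
  rw [sub_mul, one_mul, map_sub, mul_assoc, PowerSeries.coeff_C_mul]
  cases d with
  | zero => simp [geomSeries]
  | succ d => simp [geomSeries, PowerSeries.coeff_succ_X_mul, PowerSeries.coeff_one, pow_succ']

theorem geomSeries_zero : geomSeries (0 : R) = 1 := by
  simpa using one_sub_mul_geomSeries (0 : R)

theorem map_geomSeries (f : R →+* S) (x : R) :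
    PowerSeries.map f (geomSeries x) = geomSeries (f x) := by
  ext d; simp [geomSeries]

theorem map_elemSeries (f : R →+* S) (x : Fin n → R) :
    PowerSeries.map f (elemSeries x) = elemSeries (f ∘ x) := by
  simp [elemSeries, map_prod]

theorem map_homSeries (f : R →+* S) (x : Fin n → R) (m : ℕ) :
    PowerSeries.map f (homSeries x m) = homSeries (f ∘ x) m := by
  simp [homSeries, map_prod, map_geomSeries]

theorem elemSeries_succ (x : Fin (n + 1) → R) :
    elemSeries x = (1 + PowerSeries.C (x 0) * PowerSeries.X) * elemSeries (Fin.tail x) := by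
  simp [elemSeries, Fin.prod_univ_succ, Fin.tail]

theorem homSeries_succ (x : Fin (n + 1) → R) (m : ℕ) :
    homSeries x (m + 1) = geomSeries (x 0) * homSeries (Fin.tail x) m := by
  simp [homSeries, Finset.prod_filter, Fin.prod_univ_succ, Fin.tail]

theorem homSeries_zero (x : Fin n → R) : homSeries x 0 = 1 := by
  simp [homSeries]

theorem coeff_prod_one_add {ι : Type*} (b : ι → R) (s : Finset ι) (d : ℕ) :
    PowerSeries.coeff d (∏ i ∈ s, (1 + PowerSeries.C (b i) * PowerSeries.X)) =
      ∑ t ∈ s.powersetCard d, ∏ i ∈ t, b i := by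
  rw [Finset.prod_one_add]
  simp only [Finset.prod_mul_distrib, Finset.prod_const, ← map_prod, map_sum,
    PowerSeries.coeff_C_mul, PowerSeries.coeff_X_pow, mul_ite, mul_one, mul_zero]
  rw [← Finset.sum_filter]
  refine Finset.sum_congr ?_ fun _ _ => rfl
  ext t
  simp [Finset.mem_powersetCard, eq_comm]

theorem coeff_prod_one_add_eq_zero {ι : Type*} (b : ι → R) (s : Finset ι) {d : ℕ}
    (hd : s.card < d) :
    PowerSeries.coeff d (∏ i ∈ s, (1 + PowerSeries.C (b i) * PowerSeries.X)) = 0 := by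
  rw [coeff_prod_one_add, Finset.powersetCard_eq_empty.2 hd, Finset.sum_empty]

theorem coeff_prod_one_sub_eq_zero {ι : Type*} (b : ι → R) (s : Finset ι) {d : ℕ}
    (hd : s.card < d) :
    PowerSeries.coeff d (∏ i ∈ s, (1 - PowerSeries.C (b i) * PowerSeries.X)) = 0 := by
  simpa [sub_eq_add_neg] using coeff_prod_one_add_eq_zero (fun i => -b i) s hd

theorem coeff_elemSeries (d : ℕ) :
    PowerSeries.coeff d (elemSeries (MvPolynomial.X : Fin n → MvPolynomial (Fin n) R)) =
      MvPolynomial.esymm (Fin n) R d := by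
  rw [elemSeries, coeff_prod_one_add, MvPolynomial.esymm]

theorem coeff_homSeries (F : Type*) [Field F] (d m : ℕ) :
    PowerSeries.coeff d (homSeries (MvPolynomial.X : Fin n → MvPolynomial (Fin n) F) m) =
      hpoly F n d m := by
  rw [homSeries, PowerSeries.coeff_prod, hpoly]
  symm
  refine Finset.sum_bij' (fun s _ => Multiset.toFinsupp s.1)
    (fun a ha => ⟨Finsupp.toMultiset a, ?_⟩) ?_ ?_ ?_ ?_ ?_
  · rw [Finset.mem_finsuppAntidiag] at ha
    rw [Finsupp.card_toMultiset, Finsupp.sum, ← ha.1]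
    exact Finset.sum_subset ha.2 (by simp)
  · intro s hs
    rw [Finset.mem_filter] at hs
    rw [Finset.mem_finsuppAntidiag]
    have hsub : (Multiset.toFinsupp s.1).support ⊆
        Finset.univ.filter fun i : Fin n => (i : ℕ) < m := by
      intro i hi
      simp only [Multiset.toFinsupp_support, Multiset.mem_toFinset] at hi
      simpa using hs.2 i hi
    refine ⟨?_, hsub⟩
    rw [← Finset.sum_subset (f := ⇑(Multiset.toFinsupp s.1)) hsub (by simp)]
    have := Finsupp.card_toMultiset (Multiset.toFinsupp s.1)
    rw [Multiset.toFinsupp_toMultiset, s.2] at this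
    exact this.symm
  · intro a ha
    rw [Finset.mem_finsuppAntidiag] at ha
    refine Finset.mem_filter.2 ⟨Finset.mem_univ _, fun j hj => ?_⟩
    have hj' : j ∈ Finsupp.toMultiset a := hj
    rw [Finsupp.mem_toMultiset] at hj'
    simpa using ha.2 hj'
  · intro s hs
    apply Subtype.ext
    simp
  · intro a ha
    simp
  · intro s hs
    rw [Finset.mem_filter] at hs
    have hsub : s.1.toFinset ⊆ Finset.univ.filter fun i : Fin n => (i : ℕ) < m := by
      intro i hi
      simpa using hs.2 i (by simpa using hi)
    simp only [geomSeries, PowerSeries.coeff_mk, Multiset.toFinsupp_apply]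
    rw [Finset.prod_multiset_map_count]
    exact Finset.prod_subset hsub fun i _ hi => by
      rw [Multiset.mem_toFinset] at hi
      rw [show Multiset.count i s.1 = 0 from Multiset.count_eq_zero.2 hi, pow_zero]

end Series

/-- The exponent sequences of length `n` dominated by a shuffle of `(r-1, …, 1, 0)` with
copies of `k-1`, described recursively by the first entry. -/
def Dominated (k : ℕ) : (n : ℕ) → ℕ → (Fin n → ℕ) → Prop
  | 0, r, _ => r = 0
  | n + 1, r, a => (a 0 < r ∧ Dominated k n (r - 1) (Fin.tail a)) ∨
      (r ≤ a 0 ∧ a 0 < k ∧ Dominated k n r (Fin.tail a))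

section Dominated

variable {k : ℕ}

theorem Dominated.le : ∀ {n r : ℕ} {a : Fin n → ℕ}, Dominated k n r a → r ≤ n
  | 0, _, _, h => le_of_eq h
  | n + 1, r, a, h => by
    rcases h with ⟨_, h⟩ | ⟨_, _, h⟩ <;> have := h.le <;> omega

theorem Dominated.pred : ∀ {n r : ℕ} {a : Fin n → ℕ}, r ≤ k → Dominated k n r a →
    Dominated k n (r - 1) a
  | 0, r, _, _, h => by
    have : r = 0 := h
    subst this; rfl
  | n + 1, r, a, hr, h => by
    rcases h with ⟨h0, h⟩ | ⟨h0, h1, h⟩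
    · by_cases h2 : a 0 < r - 1
      · exact Or.inl ⟨h2, h.pred (by omega)⟩
      · exact Or.inr ⟨by omega, by omega, h⟩
    · exact Or.inr ⟨by omega, h1, h.pred hr⟩

theorem dominated_iff (hk : 1 ≤ k) : ∀ {n r : ℕ} {a : Fin n → ℕ}, r ≤ k → r ≤ n →
    (Dominated k n r a ↔
      ∃ L : List ℕ, IsShuffle ((List.range r).reverse) (List.replicate (n - r) (k - 1)) L ∧
        ∀ j : Fin n, a j ≤ L.getD (j : ℕ) 0)
  | 0, r, a, hrk, hrn => by
    obtain rfl : r = 0 := by omega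
    exact ⟨fun _ => ⟨[], IsShuffle.nil, fun j => j.elim0⟩, fun _ => rfl⟩
  | n + 1, r, a, hrk, hrn => by
    constructor
    · rintro (⟨h0, h⟩ | ⟨h0, h1, h⟩)
      · obtain ⟨r, rfl⟩ : ∃ s, r = s + 1 := ⟨r - 1, by omega⟩
        obtain ⟨L, hL, hle⟩ := (dominated_iff hk (by omega) (by omega)).1 h
        refine ⟨r :: L, ?_, Fin.cases ?_ fun j => ?_⟩
        · rw [List.range_succ, List.reverse_append, Nat.add_sub_add_right]
          exact IsShuffle.left hL
        · simpa using Nat.le_of_lt_succ h0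
        · exact hle j
      · have hr := h.le
        obtain ⟨L, hL, hle⟩ := (dominated_iff hk hrk hr).1 h
        refine ⟨(k - 1) :: L, ?_, Fin.cases ?_ fun j => ?_⟩
        · rw [Nat.sub_add_comm hr]
          exact IsShuffle.right hL
        · simpa using Nat.le_sub_one_of_lt h1
        · exact hle j
    · rintro ⟨L, hL, hle⟩
      generalize h1 : (List.range r).reverse = l₁ at hL
      generalize h2 : List.replicate (n + 1 - r) (k - 1) = l₂ at hL
      have h0 := hle 0
      have htail : ∀ b M, L = b :: M → ∀ j : Fin n, Fin.tail a j ≤ M.getD (j : ℕ) 0 := by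
        rintro b M rfl j
        exact hle j.succ
      cases hL with
      | nil =>
        have e1 := congrArg List.length h1
        have e2 := congrArg List.length h2
        simp at e1 e2
        omega
      | @left b l₁ l₂ M hM =>
        obtain ⟨r, rfl⟩ : ∃ s, r = s + 1 := by
          refine ⟨r - 1, ?_⟩
          have := congrArg List.length h1
          simp at this
          omega
        rw [List.range_succ, List.reverse_append] at h1
        simp only [List.reverse_singleton, List.singleton_append, List.cons.injEq] at h1
        obtain ⟨rfl, rfl⟩ := h1
        subst h2
        refine Or.inl ⟨by simpa [Nat.lt_succ_iff] using h0, ?_⟩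
        refine (dominated_iff hk (by omega) (by omega)).2 ⟨M, ?_, htail _ _ rfl⟩
        simpa using hM
      | @right b l₁ l₂ M hM =>
        have hr : r ≤ n := by
          have := congrArg List.length h2
          simp at this
          omega
        rw [Nat.sub_add_comm hr, List.replicate_succ] at h2
        simp only [List.cons.injEq] at h2
        obtain ⟨rfl, rfl⟩ := h2
        subst h1
        have hd : Dominated k n r (Fin.tail a) :=
          (dominated_iff hk hrk hr).2 ⟨M, hM, htail _ _ rfl⟩
        have h0' : a 0 ≤ k - 1 := by simpa using h0
        by_cases h3 : a 0 < r
        · exact Or.inl ⟨h3, hd.pred hrk⟩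
        · exact Or.inr ⟨by omega, by omega, hd⟩

theorem exists_isStaircase_iff {n : ℕ} (hk : 1 ≤ k) (hkn : k ≤ n) {a : Fin n → ℕ} :
    (∃ s, IsStaircase n k s ∧ ∀ j, a j ≤ s j) ↔ Dominated k n k a := by
  rw [dominated_iff hk le_rfl hkn]
  constructor
  · rintro ⟨s, ⟨L, hL, hs⟩, h⟩
    exact ⟨L, hL, fun j => hs j ▸ h j⟩
  · rintro ⟨L, hL, h⟩
    exact ⟨fun j => L.getD (j : ℕ) 0, ⟨L, hL, fun _ => rfl⟩, h⟩

end Dominated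

/-- The ideal generated by the complete homogeneous polynomials of degree `k` in initial
segments of the variables and the top `r` elementary symmetric polynomials. -/
def staircaseIdeal (R : Type*) [CommRing R] (n k r : ℕ) : Ideal (MvPolynomial (Fin n) R) :=
  Ideal.span ({f | ∃ m, 1 ≤ m ∧ m ≤ n ∧ f = PowerSeries.coeff k (homSeries MvPolynomial.X m)} ∪
    {f | ∃ d, n < d + r ∧ d ≤ n ∧ f = PowerSeries.coeff d (elemSeries MvPolynomial.X)})

theorem jideal_eq (F : Type*) [Field F] {n k : ℕ} (hkn : k ≤ n) :
    Jideal F n k = staircaseIdeal F n k k := by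
  simp only [Jideal, staircaseIdeal, coeff_homSeries, coeff_elemSeries]
  congr! 7
  omega

/-- The polynomials supported on dominated exponents. -/
def dominatedSpan (R : Type*) [CommRing R] (n k r : ℕ) :
    Submodule R (MvPolynomial (Fin n) R) :=
  MvPolynomial.restrictSupport R {a | Dominated k n r a}

theorem mem_dominatedSpan {R : Type*} [CommRing R] {n k r : ℕ} {f : MvPolynomial (Fin n) R} :
    f ∈ dominatedSpan R n k r ↔ ∀ a, MvPolynomial.coeff a f ≠ 0 → Dominated k n r a := by
  simp [dominatedSpan, MvPolynomial.mem_restrictSupport_iff, Set.subset_def]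

section Spanning

variable {R : Type*} [CommRing R] {n k r : ℕ}

theorem exists_eq_rename_succ_add_X_mul (p : MvPolynomial (Fin (n + 1)) R) :
    ∃ (q : MvPolynomial (Fin n) R) (p' : MvPolynomial (Fin (n + 1)) R),
      p = MvPolynomial.rename Fin.succ q + MvPolynomial.X 0 * p' := by
  induction p using MvPolynomial.induction_on with
  | C c => exact ⟨MvPolynomial.C c, 0, by simp⟩
  | add p₁ p₂ h₁ h₂ =>
    obtain ⟨q₁, p₁', rfl⟩ := h₁
    obtain ⟨q₂, p₂', rfl⟩ := h₂
    exact ⟨q₁ + q₂, p₁' + p₂', by rw [map_add]; ring⟩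
  | mul_X p i h =>
    obtain ⟨q, p', rfl⟩ := h
    refine Fin.cases ?_ (fun j => ?_) i
    · exact ⟨0, _, by rw [map_zero, zero_add, mul_comm]⟩
    · exact ⟨q * MvPolynomial.X j, p' * MvPolynomial.X j.succ, by
        rw [map_mul, MvPolynomial.rename_X]; ring⟩

theorem homSeries_X_succ (m : ℕ) :
    homSeries (MvPolynomial.X : _ → MvPolynomial (Fin (n + 1)) R) (m + 1) =
      geomSeries (MvPolynomial.X 0) * PowerSeries.map
        (MvPolynomial.rename Fin.succ : MvPolynomial (Fin n) R →ₐ[R] _).toRingHom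
        (homSeries MvPolynomial.X m) := by
  rw [homSeries_succ, map_homSeries]
  congr 2
  ext1 j
  simp [Fin.tail]

theorem elemSeries_X_succ :
    elemSeries (MvPolynomial.X : _ → MvPolynomial (Fin (n + 1)) R) =
      (1 + PowerSeries.C (MvPolynomial.X 0) * PowerSeries.X) * PowerSeries.map
        (MvPolynomial.rename Fin.succ : MvPolynomial (Fin n) R →ₐ[R] _).toRingHom
        (elemSeries MvPolynomial.X) := by
  rw [elemSeries_succ, map_elemSeries]
  congr 2
  ext1 j
  simp [Fin.tail]

theorem coeff_elemSeries_X_succ (d : ℕ) :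
    PowerSeries.coeff (d + 1) (elemSeries (MvPolynomial.X : _ → MvPolynomial (Fin (n + 1)) R)) =
      MvPolynomial.rename Fin.succ (PowerSeries.coeff (d + 1)
        (elemSeries (MvPolynomial.X : _ → MvPolynomial (Fin n) R))) +
      MvPolynomial.X 0 * MvPolynomial.rename Fin.succ (PowerSeries.coeff d
        (elemSeries (MvPolynomial.X : _ → MvPolynomial (Fin n) R))) := by
  rw [elemSeries_X_succ, add_mul, one_mul, map_add, mul_assoc, PowerSeries.coeff_C_mul,
    PowerSeries.coeff_succ_X_mul]
  simp

theorem coeff_zero_elemSeries (x : Fin n → R) : PowerSeries.coeff 0 (elemSeries x) = 1 := by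
  simp [elemSeries, map_prod]

theorem coeff_elemSeries_eq_zero (x : Fin n → R) {d : ℕ} (hd : n < d) :
    PowerSeries.coeff d (elemSeries x) = 0 :=
  coeff_prod_one_add_eq_zero _ _ (by simpa using hd)

theorem X_mul_dvd_coeff_homSeries_sub (m d : ℕ) :
    MvPolynomial.X 0 ∣ PowerSeries.coeff d
        (homSeries (MvPolynomial.X : _ → MvPolynomial (Fin (n + 1)) R) (m + 1)) -
      MvPolynomial.rename Fin.succ (PowerSeries.coeff d
        (homSeries (MvPolynomial.X : _ → MvPolynomial (Fin n) R) m)) := by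
  have h := one_sub_mul_geomSeries (MvPolynomial.X 0 : MvPolynomial (Fin (n + 1)) R)
  have h' : geomSeries (MvPolynomial.X 0 : MvPolynomial (Fin (n + 1)) R) = 1 +
      PowerSeries.C (MvPolynomial.X 0) * (PowerSeries.X * geomSeries (MvPolynomial.X 0)) := by
    rw [← h]; ring
  rw [homSeries_X_succ, h', add_mul, one_mul, map_add, mul_assoc, PowerSeries.coeff_C_mul]
  simp

theorem X_pow_mem_staircaseIdeal :
    (MvPolynomial.X 0 : MvPolynomial (Fin (n + 1)) R) ^ k ∈ staircaseIdeal R (n + 1) k r := by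
  refine Ideal.subset_span (Or.inl ⟨1, le_rfl, by omega, ?_⟩)
  rw [homSeries_X_succ, homSeries_zero]
  simp [geomSeries]

theorem coeff_elemSeries_mem {d : ℕ} (hd : n < d + r) :
    PowerSeries.coeff d (elemSeries MvPolynomial.X) ∈ staircaseIdeal R n k r := by
  by_cases h : d ≤ n
  · exact Ideal.subset_span (Or.inr ⟨d, hd, h, rfl⟩)
  · rw [coeff_elemSeries_eq_zero _ (by omega)]
    exact zero_mem _

theorem X_pow_mul_rename_coeff_elemSeries_mem (j d : ℕ) (hj : j ≤ r) (hd : d + j = n + 1) :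
    MvPolynomial.X 0 ^ j * MvPolynomial.rename Fin.succ (PowerSeries.coeff d
      (elemSeries (MvPolynomial.X : _ → MvPolynomial (Fin n) R))) ∈
        staircaseIdeal R (n + 1) k r := by
  induction j generalizing d with
  | zero =>
    rw [coeff_elemSeries_eq_zero _ (by omega)]
    simp
  | succ j ih =>
    have h1 := ih (d + 1) (by omega) (by omega)
    have h2 := coeff_elemSeries_mem (R := R) (n := n + 1) (k := k) (r := r) (d := d + 1) (by omega)
    have h3 := sub_mem (Ideal.mul_mem_left _ (MvPolynomial.X 0 ^ j) h2) h1
    rw [coeff_elemSeries_X_succ] at h3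
    convert h3 using 1
    ring

theorem X_pow_mul_rename_mem {i : ℕ} {p : MvPolynomial (Fin n) R}
    (hp : p ∈ staircaseIdeal R n k (if i < r then r - 1 else r)) :
    MvPolynomial.X 0 ^ i * MvPolynomial.rename Fin.succ p ∈
      staircaseIdeal R (n + 1) k r ⊔ Ideal.span {MvPolynomial.X 0 ^ (i + 1)} := by
  have hX : ∀ q, MvPolynomial.X 0 ∣ q → MvPolynomial.X 0 ^ i * q ∈
      staircaseIdeal R (n + 1) k r ⊔ Ideal.span {MvPolynomial.X 0 ^ (i + 1)} := by
    rintro _ ⟨q, rfl⟩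
    refine Ideal.mem_sup_right (Ideal.mem_span_singleton.2 ⟨q, by ring⟩)
  induction hp using Submodule.span_induction with
  | zero => simp
  | add p q _ _ hp hq => rw [map_add, mul_add]; exact add_mem hp hq
  | smul c p _ hp =>
    rw [smul_eq_mul, map_mul, mul_left_comm]
    exact Ideal.mul_mem_left _ _ hp
  | mem p hp =>
    rcases hp with ⟨m, hm, hmn, rfl⟩ | ⟨d, hd, hdn, rfl⟩
    · have h1 := hX _ (X_mul_dvd_coeff_homSeries_sub (R := R) (n := n) m k)
      have h2 : PowerSeries.coeff k (homSeries MvPolynomial.X (m + 1)) ∈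
          staircaseIdeal R (n + 1) k r :=
        Ideal.subset_span (Or.inl ⟨m + 1, by omega, by omega, rfl⟩)
      have h3 := sub_mem (Ideal.mem_sup_left (Ideal.mul_mem_left _ (MvPolynomial.X 0 ^ i) h2)) h1
      convert h3 using 1
      ring
    · by_cases h : n + 1 < d + r
      · have h2 := coeff_elemSeries_mem (R := R) (k := k) h
        cases d with
        | zero =>
          rw [coeff_zero_elemSeries] at h2 ⊢
          refine Ideal.mem_sup_left ?_
          rw [(Ideal.eq_top_iff_one _).2 h2]
          trivial
        | succ d =>
          rw [coeff_elemSeries_X_succ] at h2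
          have h3 := sub_mem (Ideal.mem_sup_left (Ideal.mul_mem_left _ (MvPolynomial.X 0 ^ i) h2))
            (hX _ (dvd_mul_right _ (MvPolynomial.rename Fin.succ (PowerSeries.coeff d
              (elemSeries (MvPolynomial.X : _ → MvPolynomial (Fin n) R))))))
          convert h3 using 1
          ring
      · have hir : ¬ i < r := fun hir => by
          rw [if_pos hir] at hd; omega
        rw [if_neg hir] at hd
        obtain ⟨j, rfl⟩ : ∃ j, i = j + r := ⟨i - r, by omega⟩
        have h1 := Ideal.mul_mem_left _ (MvPolynomial.X 0 ^ j)
          (X_pow_mul_rename_coeff_elemSeries_mem (R := R) (k := k) (r := r) (n := n) r d le_rfl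
            (by omega))
        refine Ideal.mem_sup_left ?_
        convert h1 using 1
        ring

theorem finSuccEquiv_rename_succ (p : MvPolynomial (Fin n) R) :
    MvPolynomial.finSuccEquiv R n (MvPolynomial.rename Fin.succ p) = Polynomial.C p := by
  induction p using MvPolynomial.induction_on with
  | C c => simp [MvPolynomial.finSuccEquiv_apply]
  | add p q hp hq => rw [map_add, map_add, hp, hq, map_add]
  | mul_X p i hp =>
    rw [map_mul, map_mul, hp, MvPolynomial.rename_X, MvPolynomial.finSuccEquiv_X_succ, map_mul]

theorem X_pow_mul_rename_mem_dominatedSpan {i : ℕ} (hi : i < k) {p : MvPolynomial (Fin n) R}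
    (hp : p ∈ dominatedSpan R n k (if i < r then r - 1 else r)) :
    MvPolynomial.X 0 ^ i * MvPolynomial.rename Fin.succ p ∈ dominatedSpan R (n + 1) k r := by
  rw [mem_dominatedSpan] at hp ⊢
  intro a ha
  rw [← Finsupp.cons_tail a, ← MvPolynomial.finSuccEquiv_coeff_coeff, map_mul, map_pow,
    MvPolynomial.finSuccEquiv_X_zero, finSuccEquiv_rename_succ,
    Polynomial.coeff_X_pow_mul', Polynomial.coeff_C] at ha
  obtain h0 : a 0 = i := by
    by_contra h
    apply ha
    split_ifs <;> first | rfl | omega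
  rw [if_pos h0.ge, if_pos (by omega)] at ha
  have h1 := hp _ ha
  subst h0
  split_ifs at h1 with h
  · exact Or.inl ⟨h, h1⟩
  · exact Or.inr ⟨not_lt.1 h, hi, h1⟩

theorem exists_dominated_add_mem (hr : r ≤ k) (p : MvPolynomial (Fin n) R) :
    p ∈ dominatedSpan R n k r ⊔ (staircaseIdeal R n k r).restrictScalars R := by
  induction n generalizing r with
  | zero =>
    rcases Nat.eq_zero_or_pos r with rfl | h
    · exact Submodule.mem_sup_left (mem_dominatedSpan.2 fun _ _ => rfl)
    · have h1 := coeff_elemSeries_mem (R := R) (n := 0) (k := k) (r := r) (d := 0) (by omega)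
      rw [coeff_zero_elemSeries] at h1
      refine Submodule.mem_sup_right ?_
      rw [(Ideal.eq_top_iff_one _).2 h1]
      trivial
  | succ n ih =>
    suffices h : ∀ j i, i + j = k → ∀ p, MvPolynomial.X 0 ^ i * p ∈
        dominatedSpan R (n + 1) k r ⊔ (staircaseIdeal R (n + 1) k r).restrictScalars R by
      simpa using h k 0 (by omega) p
    intro j
    induction j with
    | zero =>
      rintro i rfl p
      exact Submodule.mem_sup_right (Ideal.mul_mem_right _ _ X_pow_mem_staircaseIdeal)
    | succ j ihj =>
      intro i hi p
      obtain ⟨q, p', rfl⟩ := exists_eq_rename_succ_add_X_mul p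
      have hq := ih (r := if i < r then r - 1 else r) (by split_ifs <;> omega) q
      obtain ⟨s, hs, t, ht, rfl⟩ := Submodule.mem_sup.1 hq
      rw [map_add, mul_add, mul_add]
      refine add_mem (add_mem ?_ ?_) ?_
      · exact Submodule.mem_sup_left (X_pow_mul_rename_mem_dominatedSpan (by omega) hs)
      · obtain ⟨u, hu, v, hv, huv⟩ := Submodule.mem_sup.1 (X_pow_mul_rename_mem ht)
        rw [← huv]
        refine add_mem (Submodule.mem_sup_right hu) ?_
        obtain ⟨w, rfl⟩ := Ideal.mem_span_singleton.1 hv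
        exact ihj (i + 1) (by omega) w
      · rw [← mul_assoc, ← pow_succ]
        exact ihj (i + 1) (by omega) p'

end Spanning

/-- The order embedding of `ℕ` omitting the value `l`. -/
def skip (l j : ℕ) : ℕ := if j < l then j else j + 1

theorem skip_injective (l : ℕ) : Function.Injective (skip l) := by
  intro i j h
  simp only [skip] at h
  split_ifs at h <;> omega

theorem skip_ne (l j : ℕ) : skip l j ≠ l := by
  simp only [skip]
  split_ifs <;> omega

/-- The points with distinct coordinates whose `i`-th coordinate is among the first `k + i` values
of `α` and whose coordinates exhaust the first `r` values of `α`. -/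
def IsPoint {A : Type*} (α : ℕ → A) {n : ℕ} (k r : ℕ) (z : Fin n → A) : Prop :=
  Function.Injective z ∧ (∀ i : Fin n, ∃ j < k + i, z i = α j) ∧ ∀ j < r, ∃ i, z i = α j

section Points

variable {A : Type*} {n k r : ℕ} {α : ℕ → A}

theorem IsPoint.cons (hα : Function.Injective α) {l : ℕ} (hl : l < k) {z : Fin n → A}
    (hz : IsPoint (α ∘ skip l) k (if l < r then r - 1 else r) z) :
    IsPoint α k r (Fin.cons (α l) z : Fin (n + 1) → A) := by
  obtain ⟨h1, h2, h3⟩ := hz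
  refine ⟨Fin.cons_injective_iff.2 ⟨?_, h1⟩,
    Fin.forall_fin_succ.2 ⟨⟨l, by simpa using hl, rfl⟩, fun i => ?_⟩, fun j hj => ?_⟩
  · rintro ⟨i, hi⟩
    obtain ⟨j, -, hj⟩ := h2 i
    exact skip_ne l j (hα (hj.symm.trans hi))
  · obtain ⟨j, hj, hji⟩ := h2 i
    refine ⟨skip l j, ?_, by simpa using hji⟩
    simp only [skip, Fin.val_succ]
    split_ifs <;> omega
  · rcases lt_trichotomy j l with h | rfl | h
    · obtain ⟨i, hi⟩ := h3 j (by split_ifs <;> omega)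
      exact ⟨i.succ, by simpa [skip, h] using hi⟩
    · exact ⟨0, rfl⟩
    · obtain ⟨i, hi⟩ := h3 (j - 1) (by split_ifs <;> omega)
      refine ⟨i.succ, ?_⟩
      simpa [skip, show ¬ j - 1 < l by omega, Nat.sub_add_cancel (show 1 ≤ j by omega)] using hi

variable [CommRing A]

theorem coeff_mem_of_eq_X_sub_C_mul {B : Type*} [CommRing B] [Algebra A B] {S : ℕ → Submodule A B}
    (hS : Antitone S) (c : A) {p q : Polynomial B}
    (hpq : p = (Polynomial.X - Polynomial.C (algebraMap A B c)) * q)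
    (hp : ∀ i, p.coeff i ∈ S i) (i : ℕ) : q.coeff i ∈ S (i + 1) := by
  suffices h : ∀ m i, q.natDegree < i + m → q.coeff i ∈ S (i + 1) from
    h (q.natDegree + 1) i (by omega)
  intro m
  induction m with
  | zero =>
    intro i hi
    rw [Polynomial.coeff_eq_zero_of_natDegree_lt (by simpa using hi)]
    exact zero_mem _
  | succ m ih =>
    intro i hi
    have h1 := hp (i + 1)
    rw [hpq, sub_mul, Polynomial.coeff_sub, Polynomial.coeff_X_mul, Polynomial.coeff_C_mul,
      ← Algebra.smul_def] at h1
    have h2 := (S (i + 1)).smul_mem c (hS (Nat.le_succ _) (ih (i + 1) (by omega)))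
    simpa using add_mem h1 h2

theorem dominatedSpan_pred_le (hr : r ≤ k) :
    dominatedSpan A n k r ≤ dominatedSpan A n k (r - 1) :=
  MvPolynomial.restrictSupport_mono _ fun _ h => Dominated.pred hr h

theorem eq_zero_of_eval_eq_zero [IsDomain A] (hα : Function.Injective α) (hr : r ≤ k)
    {f : MvPolynomial (Fin n) A} (hf : f ∈ dominatedSpan A n k r)
    (h : ∀ z, IsPoint α k r z → MvPolynomial.eval z f = 0) : f = 0 := by
  induction n generalizing r α with
  | zero =>
    rw [mem_dominatedSpan] at hf
    by_contra hne
    obtain ⟨a, ha⟩ := MvPolynomial.ne_zero_iff.1 hne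
    obtain rfl : r = 0 := hf a ha
    have h1 := h Fin.elim0 ⟨fun i => i.elim0, fun i => i.elim0, fun j hj => by omega⟩
    rw [MvPolynomial.eq_C_of_isEmpty f, MvPolynomial.eval_C] at h1
    rw [Subsingleton.elim a 0] at ha
    exact ha h1
  | succ n ih =>
    set S : ℕ → Submodule A (MvPolynomial (Fin n) A) := fun i =>
      if i < k then dominatedSpan A n k (if i < r then r - 1 else r) else ⊥ with hSdef
    have hS : Antitone S := by
      refine antitone_nat_of_succ_le fun i => ?_
      simp only [hSdef]
      split_ifs <;> first | exact bot_le | exact le_rfl | exact dominatedSpan_pred_le hr | omega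
    have key : ∀ m j (q : Polynomial (MvPolynomial (Fin n) A)), k ≤ j + m →
        (∀ i, q.coeff i ∈ S (i + j)) →
        (∀ l, j ≤ l → l < k → ∀ z : Fin n → A,
          IsPoint (α ∘ skip l) k (if l < r then r - 1 else r) z →
          MvPolynomial.eval z (q.eval (MvPolynomial.C (α l))) = 0) → q = 0 := by
      intro m
      induction m with
      | zero =>
        intro j q hj hq _
        ext1 i
        have := hq i
        simpa [hSdef, show ¬ i + j < k by omega] using this
      | succ m ihm =>
        intro j q hj hq hz
        by_cases hjk : k ≤ j
        · exact ihm j q (by omega) hq hz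
        have h0 : q.eval (MvPolynomial.C (α j)) ∈ S j := by
          rw [Polynomial.eval_eq_sum_range]
          refine sum_mem fun i _ => ?_
          rw [← map_pow, mul_comm, ← MvPolynomial.smul_eq_C_mul]
          exact Submodule.smul_mem _ _ (hS (by omega) (hq i))
        simp only [hSdef, if_pos (not_le.1 hjk)] at h0
        have h1 := ih (α := α ∘ skip j) (hα.comp (skip_injective j))
          (by split_ifs <;> omega) h0 (hz j le_rfl (by omega))
        obtain ⟨q', rfl⟩ := Polynomial.dvd_iff_isRoot.2 h1
        have h2 : q' = 0 := by
          refine ihm (j + 1) q' (by omega) (fun i => ?_) fun l hjl hl z hp => ?_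
          · have := coeff_mem_of_eq_X_sub_C_mul (S := fun i => S (i + j))
              (fun a b hab => hS (by omega)) (α j) rfl hq i
            convert this using 2
            omega
          · have := hz l (by omega) hl z hp
            simp only [Polynomial.eval_mul, Polynomial.eval_sub, Polynomial.eval_X,
              Polynomial.eval_C, map_mul, map_sub, MvPolynomial.eval_C, mul_eq_zero] at this
            refine this.resolve_left fun h3 => ?_
            have := hα (sub_eq_zero.1 h3)
            omega
        rw [h2, mul_zero]
    rw [← map_eq_zero_iff _ (MvPolynomial.finSuccEquiv A n).injective]
    refine key k 0 _ (by omega) (fun i => ?_) fun l _ hl z hz => ?_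
    · have hi : ∀ a, MvPolynomial.coeff a ((MvPolynomial.finSuccEquiv A n f).coeff i) ≠ 0 →
          i < k ∧ Dominated k n (if i < r then r - 1 else r) a := by
        intro a ha
        rw [MvPolynomial.finSuccEquiv_coeff_coeff] at ha
        rcases mem_dominatedSpan.1 hf _ ha with ⟨h0, h1⟩ | ⟨h0, h1, h2⟩
        · rw [Finsupp.cons_zero] at h0
          rw [if_pos h0]
          exact ⟨by omega, h1⟩
        · rw [Finsupp.cons_zero] at h0 h1
          rw [if_neg (by omega)]
          exact ⟨h1, h2⟩
      simp only [hSdef, add_zero]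
      split_ifs with hik hir
      · exact mem_dominatedSpan.2 fun a ha => by simpa [hir] using (hi a ha).2
      · exact mem_dominatedSpan.2 fun a ha => by simpa [hir] using (hi a ha).2
      · rw [Submodule.mem_bot]
        ext1 a
        by_contra ha
        exact hik (hi a ha).1
    · have := h _ (hz.cons hα hl)
      rw [MvPolynomial.eval_eq_eval_mv_eval'] at this
      rw [← this, Polynomial.eval_map, Polynomial.eval, Polynomial.hom_eval₂]
      simp

theorem coeff_lift_homSeries_eq_zero (hk : 1 ≤ k) {z : Fin n → A} (hz : IsPoint α k r z) {m : ℕ}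
    (hm : 1 ≤ m) (hmn : m ≤ n) :
    PowerSeries.coeff k ((∏ j ∈ Finset.range (k + m - 1),
      (1 - PowerSeries.C (α j) * PowerSeries.X)) * homSeries z m) = 0 := by
  obtain ⟨h1, h2, -⟩ := hz
  choose σ hσ hσz using h2
  have hinj : Function.Injective σ := fun i j hij => h1 (by rw [hσz, hσz, hij])
  set I := Finset.univ.filter (fun i : Fin n => (i : ℕ) < m)
  have hI : I.card = m := by
    simp [I, Fin.card_filter_val_lt, hmn]
  have hsub : I.image σ ⊆ Finset.range (k + m - 1) := by
    intro j hj
    obtain ⟨i, hi, rfl⟩ := Finset.mem_image.1 hj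
    have := hσ i
    have : (i : ℕ) < m := (Finset.mem_filter.1 hi).2
    rw [Finset.mem_range]
    omega
  have hone : ∏ i ∈ I, (1 - PowerSeries.C (α (σ i)) * PowerSeries.X) * geomSeries (z i) = 1 :=
    Finset.prod_eq_one fun i _ => by rw [hσz i, one_sub_mul_geomSeries]
  rw [← Finset.prod_sdiff hsub, mul_assoc, Finset.prod_image hinj.injOn, homSeries,
    ← Finset.prod_mul_distrib, hone, mul_one]
  apply coeff_prod_one_sub_eq_zero
  rw [Finset.card_sdiff_of_subset hsub, Finset.card_image_of_injective _ hinj, hI,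
    Finset.card_range]
  omega

theorem coeff_lift_elemSeries_eq_zero (hα : Function.Injective α) {z : Fin n → A}
    (hz : IsPoint α k r z) {d : ℕ} (hd : n < d + r) :
    PowerSeries.coeff d ((∏ j ∈ Finset.range r, geomSeries (-α j)) * elemSeries z) = 0 := by
  obtain ⟨-, -, h3⟩ := hz
  replace h3 : ∀ j : Fin r, ∃ i, z i = α j := fun j => h3 j j.2
  choose ι hι using h3
  have hinj : Function.Injective ι := fun i j hij => Fin.val_injective <| hα <| by
    rw [← hι i, ← hι j, hij]
  have hr : r ≤ n := by simpa using Fintype.card_le_of_injective ι hinj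
  have hsub : Finset.univ.image ι ⊆ Finset.univ := Finset.subset_univ _
  have hone : ∏ j : Fin r, geomSeries (-α j) *
      (1 + PowerSeries.C (z (ι j)) * PowerSeries.X) = 1 :=
    Finset.prod_eq_one fun j _ => by
      rw [hι j, mul_comm]
      simpa using one_sub_mul_geomSeries (-α j)
  rw [Finset.prod_range, elemSeries, ← Finset.prod_sdiff hsub, mul_left_comm,
    Finset.prod_image hinj.injOn, ← Finset.prod_mul_distrib, hone, mul_one]
  apply coeff_prod_one_add_eq_zero
  rw [Finset.card_sdiff_of_subset hsub, Finset.card_image_of_injective _ hinj, Finset.card_univ,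
    Finset.card_univ, Fintype.card_fin, Fintype.card_fin]
  omega

end Points

section Deformation

variable {F : Type*} [Field F] {n k r : ℕ}

theorem exists_eq_map_C_add_C_X_mul (p : MvPolynomial (Fin n) (PowerSeries F)) :
    ∃ p', p = MvPolynomial.map PowerSeries.C (MvPolynomial.map PowerSeries.constantCoeff p) +
      MvPolynomial.C PowerSeries.X * p' := by
  induction p using MvPolynomial.induction_on with
  | C c =>
    refine ⟨MvPolynomial.C (PowerSeries.mk fun p => PowerSeries.coeff (p + 1) c), ?_⟩
    rw [MvPolynomial.map_C, MvPolynomial.map_C, ← map_mul, ← map_add, add_comm,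
      ← PowerSeries.eq_X_mul_shift_add_const]
  | add p q hp hq =>
    obtain ⟨p', hp⟩ := hp
    obtain ⟨q', hq⟩ := hq
    refine ⟨p' + q', ?_⟩
    conv_lhs => rw [hp, hq]
    rw [map_add, map_add]
    ring
  | mul_X p i hp =>
    obtain ⟨p', hp⟩ := hp
    refine ⟨p' * MvPolynomial.X i, ?_⟩
    conv_lhs => rw [hp]
    rw [map_mul, map_mul, MvPolynomial.map_X, MvPolynomial.map_X]
    ring

/-- A sequence of distinct power series with zero constant term. -/
def node (F : Type*) [Field F] (j : ℕ) : PowerSeries F := PowerSeries.X ^ (j + 1)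

theorem node_injective : Function.Injective (node F) := by
  intro i j h
  have := congrArg PowerSeries.order h
  simpa [node, PowerSeries.order_X_pow] using this

theorem constantCoeff_node (j : ℕ) : PowerSeries.constantCoeff (node F j) = 0 := by
  simp [node]

theorem finite_isPoint {A : Type*} (α : ℕ → A) (n k r : ℕ) :
    {z : Fin n → A | IsPoint α k r z}.Finite := by
  refine (Set.Finite.pi' fun _ : Fin n => (Set.finite_Iio (k + n)).image α).subset fun z hz i => ?_
  obtain ⟨j, hj, h⟩ := hz.2.1 i
  exact ⟨j, by simp only [Set.mem_Iio]; omega, h.symm⟩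

/-- Evaluation of polynomials at all the points with parameters `node F`. -/
def evalPoints (F : Type*) [Field F] (n k r : ℕ) :
    MvPolynomial (Fin n) (PowerSeries F) →ₐ[PowerSeries F]
      ({z : Fin n → PowerSeries F | IsPoint (node F) k r z} → PowerSeries F) :=
  AlgHom.pi fun z => MvPolynomial.aeval z.1

theorem evalPoints_eq_zero_iff {p : MvPolynomial (Fin n) (PowerSeries F)} :
    evalPoints F n k r p = 0 ↔ ∀ z, IsPoint (node F) k r z → MvPolynomial.eval z p = 0 := by
  simp [evalPoints, funext_iff, MvPolynomial.aeval_eq_eval]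

theorem map_C_mem_of_eval_eq_zero {p : MvPolynomial (Fin n) (PowerSeries F)}
    (hp : ∀ z, IsPoint (node F) k r z → MvPolynomial.eval z p = 0) :
    MvPolynomial.map PowerSeries.C (MvPolynomial.map PowerSeries.constantCoeff p) ∈
      RingHom.ker (evalPoints F n k r) ⊔ Ideal.span {MvPolynomial.C PowerSeries.X} := by
  obtain ⟨p', h⟩ := exists_eq_map_C_add_C_X_mul p
  rw [eq_sub_of_add_eq h.symm]
  exact sub_mem (Ideal.mem_sup_left (evalPoints_eq_zero_iff.2 hp))
    (Ideal.mem_sup_right (Ideal.mem_span_singleton.2 (dvd_mul_right _ _)))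

theorem map_C_mem_of_mem_staircaseIdeal (hk : 1 ≤ k) {p : MvPolynomial (Fin n) F}
    (hp : p ∈ staircaseIdeal F n k r) :
    MvPolynomial.map PowerSeries.C p ∈
      RingHom.ker (evalPoints F n k r) ⊔ Ideal.span {MvPolynomial.C PowerSeries.X} := by
  suffices h : staircaseIdeal F n k r ≤ Ideal.comap (MvPolynomial.map PowerSeries.C)
      (RingHom.ker (evalPoints F n k r) ⊔ Ideal.span {MvPolynomial.C PowerSeries.X}) from h hp
  refine Ideal.span_le.2 ?_
  have hX : ⇑(MvPolynomial.map (σ := Fin n) (PowerSeries.constantCoeff (R := F))) ∘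
      MvPolynomial.X = MvPolynomial.X := by
    ext1 i
    simp
  have heX : ∀ z : Fin n → PowerSeries F, ⇑(MvPolynomial.eval z) ∘ MvPolynomial.X = z := by
    intro z
    ext1 i
    simp
  rintro _ (⟨m, hm, hmn, rfl⟩ | ⟨d, hd, hdn, rfl⟩)
  · have h := map_C_mem_of_eval_eq_zero (F := F) (n := n) (k := k) (r := r)
      (p := PowerSeries.coeff k ((∏ j ∈ Finset.range (k + m - 1),
        (1 - PowerSeries.C (MvPolynomial.C (node F j)) * PowerSeries.X)) *
          homSeries MvPolynomial.X m)) fun z hz => by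
        rw [← PowerSeries.coeff_map, map_mul, map_homSeries, heX, map_prod]
        simpa using coeff_lift_homSeries_eq_zero hk hz hm hmn
    rw [← PowerSeries.coeff_map, map_mul, map_homSeries, hX, map_prod] at h
    simpa [constantCoeff_node] using h
  · have h := map_C_mem_of_eval_eq_zero (F := F) (n := n) (k := k) (r := r)
      (p := PowerSeries.coeff d ((∏ j ∈ Finset.range r,
        geomSeries (-MvPolynomial.C (node F j))) * elemSeries MvPolynomial.X)) fun z hz => by
        rw [← PowerSeries.coeff_map, map_mul, map_elemSeries, heX, map_prod]
        simpa [map_geomSeries] using coeff_lift_elemSeries_eq_zero node_injective hz hd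
    rw [← PowerSeries.coeff_map, map_mul, map_elemSeries, hX, map_prod] at h
    simpa [constantCoeff_node, map_geomSeries, geomSeries_zero] using h

theorem evalPoints_mem_smul {p : MvPolynomial (Fin n) (PowerSeries F)}
    (hp : p ∈ RingHom.ker (evalPoints F n k r) ⊔ Ideal.span {MvPolynomial.C PowerSeries.X}) :
    evalPoints F n k r p ∈ Ideal.span {(PowerSeries.X : PowerSeries F)} •
      LinearMap.range (evalPoints F n k r).toLinearMap := by
  obtain ⟨u, hu, v, hv, rfl⟩ := Submodule.mem_sup.1 hp
  obtain ⟨w, rfl⟩ := Ideal.mem_span_singleton.1 hv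
  rw [map_add, (RingHom.mem_ker).1 hu, zero_add, ← MvPolynomial.smul_eq_C_mul, map_smul]
  exact Submodule.smul_mem_smul (Ideal.mem_span_singleton_self _) ⟨w, rfl⟩

theorem range_evalPoints_le (hk : 1 ≤ k) (hr : r ≤ k) :
    LinearMap.range (evalPoints F n k r).toLinearMap ≤
      (dominatedSpan (PowerSeries F) n k r).map (evalPoints F n k r).toLinearMap := by
  have := (finite_isPoint (node F) n k r).to_subtype
  refine Submodule.le_of_le_smul_of_le_jacobson_bot
    (I := Ideal.span {(PowerSeries.X : PowerSeries F)}) (IsNoetherian.noetherian _) ?_ ?_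
  · rw [IsLocalRing.jacobson_eq_maximalIdeal _ bot_ne_top, Ideal.span_singleton_le_iff_mem,
      IsLocalRing.mem_maximalIdeal, mem_nonunits_iff, PowerSeries.isUnit_iff_constantCoeff]
    simp
  · rintro _ ⟨p, rfl⟩
    obtain ⟨p', hp⟩ := exists_eq_map_C_add_C_X_mul p
    obtain ⟨s, hs, t, ht, hst⟩ := Submodule.mem_sup.1
      (exists_dominated_add_mem hr (MvPolynomial.map PowerSeries.constantCoeff p))
    rw [← hst, map_add, add_assoc] at hp
    rw [hp, map_add]
    refine add_mem (Submodule.mem_sup_left ⟨_, ?_, rfl⟩) (Submodule.mem_sup_right ?_)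
    · refine mem_dominatedSpan.2 fun a ha => mem_dominatedSpan.1 hs a fun h => ha ?_
      rw [MvPolynomial.coeff_map, h, map_zero]
    · exact evalPoints_mem_smul (add_mem (map_C_mem_of_mem_staircaseIdeal hk ht)
        (Ideal.mem_sup_right (Ideal.mem_span_singleton.2 (dvd_mul_right _ _))))

theorem eq_zero_of_mem_staircaseIdeal (hk : 1 ≤ k) (hr : r ≤ k) {f : MvPolynomial (Fin n) F}
    (hf : f ∈ dominatedSpan F n k r) (hfJ : f ∈ staircaseIdeal F n k r) : f = 0 := by
  have h1 := Submodule.smul_mono le_rfl (range_evalPoints_le hk hr)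
    (evalPoints_mem_smul (map_C_mem_of_mem_staircaseIdeal hk hfJ))
  rw [Submodule.ideal_span_singleton_smul, Submodule.mem_smul_pointwise_iff_exists] at h1
  obtain ⟨_, ⟨s, hs, rfl⟩, h2⟩ := h1
  have h3 : MvPolynomial.map PowerSeries.C f - (PowerSeries.X : PowerSeries F) • s = 0 := by
    refine eq_zero_of_eval_eq_zero (α := node F) (k := k) (r := r) node_injective hr
      (sub_mem ?_ (Submodule.smul_mem _ _ hs)) (evalPoints_eq_zero_iff.1 ?_)
    · refine mem_dominatedSpan.2 fun a ha => mem_dominatedSpan.1 hf a fun h => ha ?_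
      rw [MvPolynomial.coeff_map, h, map_zero]
    · rw [map_sub, ← h2, map_smul]
      exact sub_self _
  ext1 a
  have h4 := congrArg (fun q => PowerSeries.constantCoeff (MvPolynomial.coeff a q)) h3
  simpa [MvPolynomial.coeff_map] using h4

end Deformation

/-- The monomials `x_1^{a_1}⋯x_n^{a_n}` whose exponent sequence is
componentwise at most some `(n,k)`-staircase descend to an `F`-basis of
`S_{n,k} = F[x_1,…,x_n]/J_{n,k}`. -/
theorem staircase_basis (F : Type*) [Field F] (n k : ℕ) (hk : 1 ≤ k) (hkn : k ≤ n) :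
    LinearIndependent F
      (fun a : {a : Fin n → ℕ // ∃ s, IsStaircase n k s ∧ ∀ j, a j ≤ s j} =>
        Ideal.Quotient.mk (Jideal F n k) (∏ j, MvPolynomial.X j ^ a.1 j)) ∧
    Submodule.span F
      (Set.range
        (fun a : {a : Fin n → ℕ // ∃ s, IsStaircase n k s ∧ ∀ j, a j ≤ s j} =>
          Ideal.Quotient.mk (Jideal F n k) (∏ j, MvPolynomial.X j ^ a.1 j))) = ⊤ := by
  have hmon : ∀ a : Fin n → ℕ, (∏ j, MvPolynomial.X j ^ a j : MvPolynomial (Fin n) F) =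
      MvPolynomial.monomial (Finsupp.equivFunOnFinite.symm a) 1 := by
    intro a
    rw [MvPolynomial.monomial_eq, Finsupp.prod_fintype _ _ (by simp)]
    simp
  simp only [hmon]
  constructor
  · rw [linearIndependent_iff']
    intro t g hg a ha
    set f : MvPolynomial (Fin n) F :=
      ∑ b ∈ t, g b • MvPolynomial.monomial (Finsupp.equivFunOnFinite.symm b.1) 1 with hf
    have h0 : f = 0 := by
      refine eq_zero_of_mem_staircaseIdeal hk le_rfl (n := n) ?_ ?_
      · refine sum_mem fun b _ => Submodule.smul_mem _ _ ?_
        refine (MvPolynomial.monomial_mem_restrictSupport _).2 (Or.inl ?_)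
        exact (exists_isStaircase_iff hk hkn).1 b.2
      · rw [← jideal_eq F hkn, ← Ideal.Quotient.eq_zero_iff_mem, ← hg, hf, map_sum]
        rfl
    have h1 := congrArg (MvPolynomial.coeff (Finsupp.equivFunOnFinite.symm a.1)) h0
    rw [hf, MvPolynomial.coeff_sum, Finset.sum_eq_single_of_mem a ha] at h1
    · simpa using h1
    · intro b _ hba
      have : Finsupp.equivFunOnFinite.symm b.1 ≠ Finsupp.equivFunOnFinite.symm a.1 := fun h =>
        hba (Subtype.ext (Finsupp.equivFunOnFinite.symm.injective h))
      simp [MvPolynomial.coeff_monomial, this]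
  · rw [eq_top_iff]
    rintro q -
    obtain ⟨p, rfl⟩ := Ideal.Quotient.mk_surjective q
    obtain ⟨s, hs, t, ht, rfl⟩ :=
      Submodule.mem_sup.1 (exists_dominated_add_mem (n := n) (le_refl k) p)
    rw [Submodule.restrictScalars_mem, ← jideal_eq F hkn] at ht
    rw [map_add, Ideal.Quotient.eq_zero_iff_mem.2 ht, add_zero, s.as_sum, map_sum]
    refine sum_mem fun a ha => ?_
    have hd := mem_dominatedSpan.1 hs a (MvPolynomial.mem_support_iff.1 ha)
    have h1 := Submodule.smul_mem _ (MvPolynomial.coeff a s) <| Submodule.subset_span (R := F) <|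
      Set.mem_range_self (f := fun a : {a : Fin n → ℕ // ∃ s, IsStaircase n k s ∧ ∀ j, a j ≤ s j} =>
        Ideal.Quotient.mk (Jideal F n k)
          (MvPolynomial.monomial (Finsupp.equivFunOnFinite.symm a.1) (1 : F)))
      ⟨a, (exists_isStaircase_iff hk hkn).2 hd⟩
    convert h1 using 1
    rw [← mul_one (MvPolynomial.coeff a s), ← smul_eq_mul, ← MvPolynomial.smul_monomial]
    simp
    rfl


end OSPHecke
end
end

section
/- Let F be a field and k ≤ n positive integers. For every 1 ≤ i ≤ n−1, the isobaric Demazure operator π_i maps the ideal J_{n,k} ⊆ F[x_1,…,x_n] into itself: π_i(J_{n,k}) ⊆ J_{n,k}. Consequently π_i induces a well-defined F-linear operator on the quotient S_{n,k} = F[x_1,…,x_n]/J_{n,k}. -/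
open scoped Classical
open MvPolynomial

noncomputable section

namespace OSPHecke

theorem Xv_of_lt (F : Type*) [Field F] {n t : ℕ} (h : t < n) :
    Xv F n t = X ⟨t, h⟩ :=
  dif_pos h

theorem adjSwap_of_lt {n t : ℕ} (h : t + 1 < n) :
    adjSwap n t = Equiv.swap ⟨t, Nat.lt_of_succ_lt h⟩ ⟨t + 1, h⟩ :=
  dif_pos h

/-- `h_{d+1}(x_1, …, x_{m+1}) = h_{d+1}(x_1, …, x_m) + x_{m+1} h_d(x_1, …, x_{m+1})`. -/
theorem hpoly_succ_succ (F : Type*) [Field F] (n d m : ℕ) (hm : m < n) :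
    hpoly F n (d + 1) (m + 1) = hpoly F n (d + 1) m + Xv F n m * hpoly F n d (m + 1) := by
  have hsplit := Finset.sum_filter_add_sum_filter_not
    (Finset.univ.filter fun s : Sym (Fin n) (d + 1) => ∀ j ∈ s.1, (j : ℕ) < m + 1)
    (fun s => (⟨m, hm⟩ : Fin n) ∉ s.1)
    (fun s => (s.1.map (X : Fin n → MvPolynomial (Fin n) F)).prod)
  rw [hpoly, ← hsplit]
  congr 1
  · rw [hpoly, Finset.filter_filter]
    refine Finset.sum_congr (Finset.filter_congr fun s _ => ?_) fun _ _ => rfl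
    constructor
    · rintro ⟨h1, h2⟩ j hj
      have hne : (j : ℕ) ≠ m := fun h => h2 ((Fin.ext h : j = ⟨m, hm⟩) ▸ hj)
      have := h1 j hj
      omega
    · exact fun h => ⟨fun j hj => (h j hj).trans (Nat.lt_succ_self m),
        fun hj => lt_irrefl m (h _ hj)⟩
  · rw [hpoly, Finset.mul_sum, Finset.filter_filter, Xv_of_lt F hm]
    symm
    refine Finset.sum_bij (fun s _ => (⟨m, hm⟩ : Fin n) ::ₛ s) ?_ ?_ ?_ ?_
    · intro s hs
      simp only [Finset.mem_filter, Finset.mem_univ, true_and, not_not] at hs ⊢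
      refine ⟨fun j hj => ?_, Multiset.mem_cons_self _ _⟩
      rcases Multiset.mem_cons.1 hj with rfl | hj
      · exact Nat.lt_succ_self m
      · exact hs j hj
    · intro s _ s' _ h
      exact Sym.cons_inj_right _ _ _ |>.1 h
    · intro s hs
      simp only [Finset.mem_filter, Finset.mem_univ, true_and, not_not] at hs
      refine ⟨s.erase ⟨m, hm⟩ hs.2, ?_, Sym.cons_erase hs.2⟩
      simp only [Finset.mem_filter, Finset.mem_univ, true_and]
      exact fun j hj => hs.1 j (Multiset.mem_of_mem_erase hj)
    · intro s _
      change _ = (Multiset.map X (_ ::ₘ s.1)).prod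
      rw [Multiset.map_cons, Multiset.prod_cons]

/-- `h_d(x_1, …, x_m)` is invariant under permutations preserving `{x_1, …, x_m}`. -/
theorem rename_hpoly (F : Type*) [Field F] (n d m : ℕ) (σ : Equiv.Perm (Fin n))
    (hσ : ∀ j, (σ j : ℕ) < m ↔ (j : ℕ) < m) :
    rename σ (hpoly F n d m) = hpoly F n d m := by
  rw [hpoly, map_sum]
  refine Finset.sum_equiv (Sym.equivCongr σ) (fun s => ?_) fun s _ => ?_
  · simp only [Finset.mem_filter, Finset.mem_univ, true_and]
    change _ ↔ ∀ j ∈ s.1.map σ, (j : ℕ) < m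
    simp [hσ]
  · change _ = ((s.1.map σ).map X).prod
    rw [map_multiset_prod, Multiset.map_map, Multiset.map_map]
    simp [Function.comp_def]

theorem adjSwap_val_lt_iff {n t m : ℕ} (ht : t + 1 < n) (hm : m ≠ t + 1) (j : Fin n) :
    (adjSwap n t j : ℕ) < m ↔ (j : ℕ) < m := by
  rw [adjSwap_of_lt ht, Equiv.swap_apply_def]
  split_ifs with h1 h2
  · subst h1; simp only; omega
  · subst h2; simp only; omega
  · rfl

/-- `f - s_{ij}(f)` is divisible by `x_i - x_j`. -/
theorem X_sub_X_dvd_sub_rename_swap {σ R : Type*} [CommRing R] [DecidableEq σ] (i j : σ)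
    (f : MvPolynomial σ R) :
    (X i - X j : MvPolynomial σ R) ∣ f - rename (Equiv.swap i j) f := by
  induction f using MvPolynomial.induction_on with
  | C a => simp
  | add p q hp hq =>
    rw [map_add, add_sub_add_comm]
    exact dvd_add hp hq
  | mul_X p l hp =>
    have hX : (X i - X j : MvPolynomial σ R) ∣ X l - X (Equiv.swap i j l) := by
      rw [Equiv.swap_apply_def]
      split_ifs with h1 h2
      · rw [h1]
      · rw [h2, ← dvd_neg, neg_sub]
      · simp
    have hsplit : p * X l - rename (Equiv.swap i j) (p * X l) =
        (p - rename (Equiv.swap i j) p) * X l +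
          rename (Equiv.swap i j) p * (X l - X (Equiv.swap i j l)) := by
      rw [map_mul, rename_X]; ring
    rw [hsplit]
    exact dvd_add (hp.mul_right _) (hX.mul_left _)

/-- The difference `h_k(x_1, …, x_i) - s_i h_k(x_1, …, x_i)` equals
`(x_i - x_{i+1}) h_{k-1}(x_1, …, x_{i+1})`. -/
theorem hpoly_sub_rename_adjSwap (F : Type*) [Field F] (n d t : ℕ) (ht : t + 1 < n) :
    (Xv F n t - Xv F n (t + 1)) * hpoly F n d (t + 2) =
      hpoly F n (d + 1) (t + 1) - rename (adjSwap n t) (hpoly F n (d + 1) (t + 1)) := by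
  have hrec := hpoly_succ_succ F n d (t + 1) ht
  have hren := congrArg (rename (adjSwap n t)) hrec
  have hX : rename (adjSwap n t) (Xv F n (t + 1)) = Xv F n t := by
    rw [Xv_of_lt F ht, Xv_of_lt F (Nat.lt_of_succ_lt ht), rename_X, adjSwap_of_lt ht,
      Equiv.swap_apply_right]
  have hinv (e : ℕ) : rename (adjSwap n t) (hpoly F n e (t + 2)) = hpoly F n e (t + 2) :=
    rename_hpoly F n e (t + 2) _ (adjSwap_val_lt_iff ht (by omega))
  rw [map_add, map_mul, hX, hinv, hinv] at hren
  linear_combination hrec - hren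

/-- For each generator `g` of `J_{n,k}`, the product of `x_{i+1}` with the divided difference
of `g` lies in `J_{n,k}`. -/
theorem exists_dividedDifference_generator (F : Type*) [Field F] (n k : ℕ) (hk : 1 ≤ k)
    (t : ℕ) (ht : t + 1 < n) {g : MvPolynomial (Fin n) F}
    (hg : g ∈ {f | ∃ m, 1 ≤ m ∧ m ≤ n ∧ f = hpoly F n k m} ∪
      {f | ∃ d, n - k < d ∧ d ≤ n ∧ f = esymm (Fin n) F d}) :
    ∃ q, Xv F n (t + 1) * q ∈ Jideal F n k ∧
      (Xv F n t - Xv F n (t + 1)) * q = g - rename (adjSwap n t) g := by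
  rcases hg with ⟨m, hm1, hmn, rfl⟩ | ⟨d, -, -, rfl⟩
  · by_cases hmt : m = t + 1
    · obtain ⟨d, rfl⟩ : ∃ d, k = d + 1 := ⟨k - 1, by omega⟩
      subst hmt
      refine ⟨hpoly F n d (t + 2), ?_, hpoly_sub_rename_adjSwap F n d t ht⟩
      have hmem (m : ℕ) (h1 : 1 ≤ m) (h2 : m ≤ n) : hpoly F n (d + 1) m ∈ Jideal F n (d + 1) :=
        Ideal.subset_span (Or.inl ⟨m, h1, h2, rfl⟩)
      rw [← sub_eq_of_eq_add' (hpoly_succ_succ F n d (t + 1) ht)]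
      exact sub_mem (hmem _ (by omega) (by omega)) (hmem _ hm1 hmn)
    · refine ⟨0, by simp, ?_⟩
      rw [rename_hpoly F n k m _ (adjSwap_val_lt_iff ht hmt), sub_self, mul_zero]
  · refine ⟨0, by simp, ?_⟩
    rw [rename_esymm, sub_self, mul_zero]

/-- The isobaric Demazure operator `π_i` maps `J_{n,k}` into itself:
for every `f ∈ J_{n,k}` there is `g ∈ J_{n,k}` (necessarily unique, since `F[x]` is a
domain) with `(x_i - x_{i+1})·g = x_i·f - x_{i+1}·s_i(f)`, i.e. `g = π_i(f)`.
(Indices are 0-based: the pair `(t, t+1)` is the paper's `(i, i+1)`.) -/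
theorem demazure_preserves_Jideal (F : Type*) [Field F] (n k : ℕ)
    (hk : 1 ≤ k) (hkn : k ≤ n) (t : ℕ) (ht : t + 1 < n) :
    ∀ f ∈ Jideal F n k, ∃ g ∈ Jideal F n k,
      (Xv F n t - Xv F n (t + 1)) * g =
        Xv F n t * f -
          Xv F n (t + 1) * MvPolynomial.rename (⇑(adjSwap n t)) f := by
  intro f hf
  refine Submodule.closure_induction ⟨0, zero_mem _, by simp⟩ ?_ ?_ hf
  · rintro x y - - ⟨g, hg, hgx⟩ ⟨g', hg', hgy⟩
    refine ⟨g + g', add_mem hg hg', ?_⟩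
    rw [map_add]
    linear_combination hgx + hgy
  · intro c x hx
    obtain ⟨q, hqJ, hq⟩ := exists_dividedDifference_generator F n k hk t ht hx
    obtain ⟨r, hr⟩ : (Xv F n t - Xv F n (t + 1)) ∣ c - rename (adjSwap n t) c := by
      rw [Xv_of_lt F ht, Xv_of_lt F (Nat.lt_of_succ_lt ht), adjSwap_of_lt ht]
      exact X_sub_X_dvd_sub_rename_swap _ _ _
    have hxJ : x ∈ Jideal F n k := Ideal.subset_span hx
    refine ⟨(c + Xv F n (t + 1) * r) * x + rename (adjSwap n t) c * (Xv F n (t + 1) * q),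
      add_mem (Ideal.mul_mem_left _ _ hxJ) (Ideal.mul_mem_left _ _ hqJ), ?_⟩
    rw [smul_eq_mul, map_mul]
    linear_combination (-Xv F n (t + 1) * x) * hr +
      (Xv F n (t + 1) * rename (adjSwap n t) c) * hq

end OSPHecke
end
end

section
/- Let F be a field and k ≤ n positive integers. The operators π_1,…,π_{n−1} on the free F-vector space F[OP_{n,k}] defined by: π_i(σ) = 0 if i+1 lies in a block strictly to the left of the block of i in σ; π_i(σ) = σ if i and i+1 lie in the same block of σ; and π_i(σ) = σ + s_i(σ) if i+1 lies in a block strictly to the right of the block of i (where s_i(σ) is obtained from σ by exchanging the letters i and i+1), satisfy the 0-Hecke relations: π_i² = π_i for all i; π_iπ_j = π_jπ_i whenever |i−j| > 1; and π_iπ_{i+1}π_i = π_{i+1}π_iπ_{i+1} for 1 ≤ i ≤ n−2. -/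
open scoped Classical
open MvPolynomial

noncomputable section

namespace OSPHecke

/-- The index of the block of `σ` containing `x`. -/
def blockIndex {n k : ℕ} (σ : OSP n k) (x : Fin n) : Fin k :=
  (σ.2.2.2 x).choose

section

variable {n k : ℕ}

lemma mem_block_iff (σ : OSP n k) (x : Fin n) (j : Fin k) :
    x ∈ σ.1 j ↔ blockIndex σ x = j := by
  have hx : x ∈ σ.1 (blockIndex σ x) := (σ.2.2.2 x).choose_spec
  refine ⟨fun h => ?_, fun h => h ▸ hx⟩
  by_contra hne
  exact σ.2.2.1 _ _ hne x hx h

lemma leftOf_iff (σ : OSP n k) (a b : Fin n) :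
    leftOf σ a b ↔ blockIndex σ b < blockIndex σ a := by
  simp [leftOf, mem_block_iff]

lemma sameBlock_iff (σ : OSP n k) (a b : Fin n) :
    sameBlock σ a b ↔ blockIndex σ a = blockIndex σ b := by
  simp [sameBlock, mem_block_iff, eq_comm]

lemma blockIndex_ospMap (e : Equiv.Perm (Fin n)) (σ : OSP n k) (x : Fin n) :
    blockIndex (ospMap e σ) x = blockIndex σ (e.symm x) := by
  rw [← mem_block_iff]
  refine Finset.mem_image.2 ⟨e.symm x, ?_, e.apply_symm_apply x⟩
  rw [mem_block_iff]

lemma ospMap_ospMap (e e' : Equiv.Perm (Fin n)) (σ : OSP n k) :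
    ospMap e (ospMap e' σ) = ospMap (e * e') σ := by
  apply Subtype.ext
  funext j
  simp [ospMap, Finset.image_image]

end

section

variable (F : Type*) [Field F] {n k : ℕ}

/-- The operator `heckeOp` as a linear map. -/
def heckeLin (a b : Fin n) : (OSP n k →₀ F) →ₗ[F] (OSP n k →₀ F) :=
  Finsupp.linearCombination F (heckeImg F a b)

lemma heckeOp_eq_heckeLin (a b : Fin n) (f : OSP n k →₀ F) :
    heckeOp F a b f = heckeLin F a b f := rfl

lemma heckeLin_single (a b : Fin n) (σ : OSP n k) :
    heckeLin F a b (Finsupp.single σ 1) =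
      if blockIndex σ b < blockIndex σ a then 0
      else if blockIndex σ a < blockIndex σ b then
        Finsupp.single σ 1 + Finsupp.single (ospMap (Equiv.swap a b) σ) 1
      else Finsupp.single σ 1 := by
  rcases lt_trichotomy (blockIndex σ a) (blockIndex σ b) with h | h | h <;>
    simp [heckeLin, heckeImg, leftOf_iff, sameBlock_iff, h, h.not_gt, ne_of_lt]

lemma heckeLin_idem (a b : Fin n) (f : OSP n k →₀ F) :
    heckeLin F a b (heckeLin F a b f) = heckeLin F a b f := by
  suffices h : heckeLin F a b ∘ₗ heckeLin F a b =
      (heckeLin F a b : (OSP n k →₀ F) →ₗ[F] (OSP n k →₀ F)) from LinearMap.congr_fun h f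
  refine Finsupp.lhom_ext' fun σ => LinearMap.ext_ring ?_
  simp only [LinearMap.comp_apply, Finsupp.lsingle_apply]
  rcases lt_trichotomy (blockIndex σ a) (blockIndex σ b) with h | h | h <;>
    simp [heckeLin_single, blockIndex_ospMap, h, h.not_gt]

lemma heckeLin_comm {a b c d : Fin n} (hac : a ≠ c) (had : a ≠ d) (hbc : b ≠ c) (hbd : b ≠ d)
    (f : OSP n k →₀ F) :
    heckeLin F a b (heckeLin F c d f) = heckeLin F c d (heckeLin F a b f) := by
  suffices h : heckeLin F a b ∘ₗ heckeLin F c d =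
      (heckeLin F c d ∘ₗ heckeLin F a b : (OSP n k →₀ F) →ₗ[F] (OSP n k →₀ F)) from
    LinearMap.congr_fun h f
  refine Finsupp.lhom_ext' fun σ => LinearMap.ext_ring ?_
  simp only [LinearMap.comp_apply, Finsupp.lsingle_apply]
  have hswap : Equiv.swap a b * Equiv.swap c d = Equiv.swap c d * Equiv.swap a b := by
    ext x
    simp only [Equiv.Perm.mul_apply, Equiv.swap_apply_def]
    grind
  rcases lt_trichotomy (blockIndex σ a) (blockIndex σ b) with h | h | h <;>
    rcases lt_trichotomy (blockIndex σ c) (blockIndex σ d) with h' | h' | h' <;>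
    simp [heckeLin_single, blockIndex_ospMap, h, h.not_gt, h', h'.not_gt,
      Equiv.swap_apply_of_ne_of_ne, hac, had, hbc, hbd, hac.symm, had.symm, hbc.symm, hbd.symm,
      ospMap_ospMap, hswap]
  abel

lemma heckeLin_braid {a b c : Fin n} (hab : a ≠ b) (hac : a ≠ c) (hbc : b ≠ c)
    (f : OSP n k →₀ F) :
    heckeLin F a b (heckeLin F b c (heckeLin F a b f)) =
      heckeLin F b c (heckeLin F a b (heckeLin F b c f)) := by
  suffices h : heckeLin F a b ∘ₗ heckeLin F b c ∘ₗ heckeLin F a b =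
      (heckeLin F b c ∘ₗ heckeLin F a b ∘ₗ heckeLin F b c :
        (OSP n k →₀ F) →ₗ[F] (OSP n k →₀ F)) from LinearMap.congr_fun h f
  refine Finsupp.lhom_ext' fun σ => LinearMap.ext_ring ?_
  simp only [LinearMap.comp_apply, Finsupp.lsingle_apply]
  have hswap : Equiv.swap a b * (Equiv.swap b c * Equiv.swap a b) =
      Equiv.swap b c * (Equiv.swap a b * Equiv.swap b c) := by
    ext x
    simp only [Equiv.Perm.mul_apply, Equiv.swap_apply_def]
    grind
  have hmap : ospMap (Equiv.swap a b) (ospMap (Equiv.swap b c) (ospMap (Equiv.swap a b) σ)) =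
      ospMap (Equiv.swap b c) (ospMap (Equiv.swap a b) (ospMap (Equiv.swap b c) σ)) := by
    simp only [ospMap_ospMap, hswap]
  have hc : Equiv.swap a b c = c := Equiv.swap_apply_of_ne_of_ne hac.symm hbc.symm
  have ha : Equiv.swap b c a = a := Equiv.swap_apply_of_ne_of_ne hab hac
  rcases lt_trichotomy (blockIndex σ a) (blockIndex σ b) with h | h | h <;>
    rcases lt_trichotomy (blockIndex σ b) (blockIndex σ c) with h' | h' | h' <;>
    rcases lt_trichotomy (blockIndex σ a) (blockIndex σ c) with h'' | h'' | h'' <;>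
    try (exfalso; order)
  all_goals
    simp [heckeLin_single, blockIndex_ospMap, h, h.not_gt, h', h'.not_gt,
      h'', h''.not_gt, ha, hc, hmap, add_assoc]
  abel

end

/-- The operators `π_1, …, π_{n-1}` on `F[OP_{n,k}]` satisfy the
0-Hecke relations: `π_i² = π_i`; `π_i π_j = π_j π_i` for `|i-j| > 1`; and the braid
relations `π_i π_{i+1} π_i = π_{i+1} π_i π_{i+1}`. (0-based indices: the operator for
the paper's `π_i` exchanges the letters `t` and `t+1` with `t = i - 1`.) -/
theorem hecke_relations_on_OSP (F : Type*) [Field F] (n k : ℕ)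
    (hk : 1 ≤ k) (hkn : k ≤ n) :
    (∀ (t : ℕ) (ht : t + 1 < n) (f : OSP n k →₀ F),
      heckeOp F ⟨t, Nat.lt_of_succ_lt ht⟩ ⟨t + 1, ht⟩
        (heckeOp F ⟨t, Nat.lt_of_succ_lt ht⟩ ⟨t + 1, ht⟩ f) =
      heckeOp F ⟨t, Nat.lt_of_succ_lt ht⟩ ⟨t + 1, ht⟩ f) ∧
    (∀ (t l : ℕ) (ht : t + 1 < n) (hl : l + 1 < n), (t + 1 < l ∨ l + 1 < t) →
      ∀ f : OSP n k →₀ F,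
        heckeOp F ⟨t, Nat.lt_of_succ_lt ht⟩ ⟨t + 1, ht⟩
          (heckeOp F ⟨l, Nat.lt_of_succ_lt hl⟩ ⟨l + 1, hl⟩ f) =
        heckeOp F ⟨l, Nat.lt_of_succ_lt hl⟩ ⟨l + 1, hl⟩
          (heckeOp F ⟨t, Nat.lt_of_succ_lt ht⟩ ⟨t + 1, ht⟩ f)) ∧
    (∀ (t : ℕ) (ht : t + 2 < n) (f : OSP n k →₀ F),
      heckeOp F ⟨t, by omega⟩ ⟨t + 1, by omega⟩
        (heckeOp F ⟨t + 1, by omega⟩ ⟨t + 2, ht⟩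
          (heckeOp F ⟨t, by omega⟩ ⟨t + 1, by omega⟩ f)) =
      heckeOp F ⟨t + 1, by omega⟩ ⟨t + 2, ht⟩
        (heckeOp F ⟨t, by omega⟩ ⟨t + 1, by omega⟩
          (heckeOp F ⟨t + 1, by omega⟩ ⟨t + 2, ht⟩ f))) := by
  simp only [heckeOp_eq_heckeLin]
  refine ⟨fun t ht f => heckeLin_idem F _ _ f,
    fun t l ht hl htl f => heckeLin_comm F ?_ ?_ ?_ ?_ f,
    fun t ht f => heckeLin_braid F ?_ ?_ ?_ f⟩ <;>
  · simp only [ne_eq, Fin.mk.injEq]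
    omega

end OSPHecke
end
end
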